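/- Value inversion theorem: fix finite S, A with |A| ≥ 2, an initial distribution d0, a discount γ ∈ [0,1), and for i = 1, 2 an MDP value function J_i induced by transition model T_i and reward function R_i (same S, A, d0, γ). Let Π be a set of stationary policies that contains a nonempty subset open in Π^+. If neither J_1 nor J_2 is constant on Π, and J_1, J_2 do not induce the same ordering on Π, then Π admits a value inversion for J_1 and J_2: there exist π, π' ∈ Π with J_1(π) > J_1(π') and J_2(π') > J_2(π). -/

import Mathlib

open Matrix

/-- `p` is a probability distribution on the finite set `S`. -/
def IsDist {S : Type*} [Fintype S] (p : S → ℝ) : Prop :=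
  (∀ s, 0 ≤ p s) ∧ ∑ s, p s = 1

/-- `π` is a stationary policy: each `π s` is a distribution over actions. -/
def IsPolicy {S A : Type*} [Fintype A] (π : S → A → ℝ) : Prop :=
  ∀ s, (∀ a, 0 ≤ π s a) ∧ ∑ a, π s a = 1

/-- `T` is a transition model: each `T s a` is a distribution over next states. -/
def IsTransModel {S A : Type*} [Fintype S] (T : S → A → S → ℝ) : Prop :=
  ∀ s a, (∀ s', 0 ≤ T s a s') ∧ ∑ s', T s a s' = 1

/-- The policy-induced transition matrix `P^π(s,s') = Σ_a π(a|s) T(s'|s,a)`. -/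
noncomputable def Pmat {S A : Type*} [Fintype A] (T : S → A → S → ℝ)
    (π : S → A → ℝ) : Matrix S S ℝ :=
  Matrix.of fun s s' => ∑ a, π s a * T s a s'

/-- The policy-induced expected reward vector `r^π(s) = Σ_a π(a|s) R(s,a)`. -/
noncomputable def rvec {S A : Type*} [Fintype A] (R : S → A → ℝ)
    (π : S → A → ℝ) : S → ℝ :=
  fun s => ∑ a, π s a * R s a

/-- The policy value `J(π) = Σ_s d0(s) V^π(s)` with `V^π = (I - γ P^π)⁻¹ r^π`. -/
noncomputable def Jval {S A : Type*} [Fintype S] [Fintype A] [DecidableEq S]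
    (T : S → A → S → ℝ) (R : S → A → ℝ) (d0 : S → ℝ) (γ : ℝ)
    (π : S → A → ℝ) : ℝ :=
  ∑ s, d0 s * (((1 : Matrix S S ℝ) - γ • Pmat T π)⁻¹ *ᵥ rvec R π) s

/-- Discounted visit counts `F^π(s,a) = μ^π(s) π(a|s)` with
`μ^π = (I - γ (P^π)ᵀ)⁻¹ d0`. -/
noncomputable def visitCount {S A : Type*} [Fintype S] [Fintype A] [DecidableEq S]
    (T : S → A → S → ℝ) (d0 : S → ℝ) (γ : ℝ) (π : S → A → ℝ) :
    S → A → ℝ :=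
  fun s a => ((((1 : Matrix S S ℝ) - γ • (Pmat T π)ᵀ)⁻¹) *ᵥ d0) s * π s a

/-- The policy value written as the inner product `J(π) = ⟨R, F^π⟩`. -/
noncomputable def JvisF {S A : Type*} [Fintype S] [Fintype A] [DecidableEq S]
    (T : S → A → S → ℝ) (R : S → A → ℝ) (d0 : S → ℝ) (γ : ℝ)
    (π : S → A → ℝ) : ℝ :=
  ∑ s, ∑ a, R s a * visitCount T d0 γ π s a

/-- The interior `Π⁺` of the policy space: policies with all entries positive. -/
def PiPlus {S A : Type*} [Fintype A] : Set (S → A → ℝ) :=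
  {π | IsPolicy π ∧ ∀ s a, 0 < π s a}

section ValueInversion

open Filter Topology

/-! ### Analyticity of the value function -/

/-- The determinant of a matrix with analytic entries is analytic. -/
lemma analyticAt_det {E n : Type*} [NormedAddCommGroup E] [NormedSpace ℝ E] [Fintype n]
    [DecidableEq n] {M : E → Matrix n n ℝ} {x : E}
    (hM : ∀ i j, AnalyticAt ℝ (fun y => M y i j) x) :
    AnalyticAt ℝ (fun y => (M y).det) x := by
  simp only [Matrix.det_apply']
  exact Finset.analyticAt_fun_sum _ fun σ _ =>
    analyticAt_const.mul (Finset.analyticAt_fun_prod _ fun i _ => hM _ _)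

/-- The inverse of an invertible matrix with analytic entries has analytic entries. -/
lemma analyticAt_matrix_inv {E n : Type*} [NormedAddCommGroup E] [NormedSpace ℝ E] [Fintype n]
    [DecidableEq n] {M : E → Matrix n n ℝ} {x : E}
    (hM : ∀ i j, AnalyticAt ℝ (fun y => M y i j) x) (hdet : (M x).det ≠ 0) (i j : n) :
    AnalyticAt ℝ (fun y => (M y)⁻¹ i j) x := by
  simp only [Matrix.inv_def, Matrix.smul_apply, smul_eq_mul, Ring.inverse_eq_inv',
    Matrix.adjugate_apply]
  refine ((analyticAt_det hM).inv hdet).mul (analyticAt_det fun k l => ?_)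
  by_cases hk : k = j
  · subst hk
    simpa using analyticAt_const
  · simpa [Matrix.updateRow_ne hk] using hM k l

variable {S A : Type*} [Fintype S] [Fintype A]
  {T : S → A → S → ℝ} {R : S → A → ℝ} {d0 : S → ℝ} {γ : ℝ} {π : S → A → ℝ}

lemma Pmat_nonneg (hT : IsTransModel T) (hπ : IsPolicy π) (s s' : S) : 0 ≤ Pmat T π s s' :=
  Finset.sum_nonneg fun a _ => mul_nonneg ((hπ s).1 a) ((hT s a).1 s')

lemma sum_Pmat (hT : IsTransModel T) (hπ : IsPolicy π) (s : S) : ∑ s', Pmat T π s s' = 1 := by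
  simp only [Pmat, Matrix.of_apply]
  rw [Finset.sum_comm]
  simp only [← Finset.mul_sum, (hT s _).2, mul_one, (hπ s).2]

/-! ### Discounted state occupancies -/

/-- `ν` solves the flow equation of the discounted state occupancy of `π`. -/
def IsOccupancy (T : S → A → S → ℝ) (d0 : S → ℝ) (γ : ℝ) (π : S → A → ℝ) (ν : S → ℝ) : Prop :=
  ∀ s', ν s' = d0 s' + γ * ∑ s, ∑ a, ν s * π s a * T s a s'

lemma sum_sum_eq_sum_mul_Pmat (ν : S → ℝ) (s' : S) :
    ∑ s, ∑ a, ν s * π s a * T s a s' = ∑ s, ν s * Pmat T π s s' := by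
  simp only [Pmat, Matrix.of_apply, Finset.mul_sum, mul_assoc]

/-- A nonnegative vector dominated by its discounted push-forward vanishes. -/
lemma eq_zero_of_le_discounted (hγ1 : γ < 1) (hT : IsTransModel T)
    (hπ : IsPolicy π) {w : S → ℝ} (hw0 : ∀ s, 0 ≤ w s)
    (hw : ∀ s', w s' ≤ γ * ∑ s, w s * Pmat T π s s') (s : S) : w s = 0 := by
  have hsum : ∑ s', w s' ≤ γ * ∑ s, w s := by
    calc ∑ s', w s' ≤ ∑ s', γ * ∑ s, w s * Pmat T π s s' := Finset.sum_le_sum fun s' _ => hw s'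
      _ = γ * ∑ s, w s := by
        rw [← Finset.mul_sum, Finset.sum_comm]
        simp only [← Finset.mul_sum, sum_Pmat hT hπ, mul_one]
  have hnn : 0 ≤ ∑ s', w s' := Finset.sum_nonneg fun s _ => hw0 s
  have hz : ∑ s', w s' = 0 := by nlinarith
  exact (Finset.sum_eq_zero_iff_of_nonneg fun s _ => hw0 s).1 hz s (Finset.mem_univ s)

lemma IsOccupancy.nonneg (hd0 : IsDist d0) (hγ0 : 0 ≤ γ) (hγ1 : γ < 1) (hT : IsTransModel T)
    (hπ : IsPolicy π) {ν : S → ℝ} (hν : IsOccupancy T d0 γ π ν) (s : S) : 0 ≤ ν s := by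
  have hw := eq_zero_of_le_discounted (w := fun s => (ν s)⁻) hγ1 hT hπ
    (fun s => negPart_nonneg _) (fun s' => ?_) s
  · exact negPart_eq_zero.1 hw
  · have hR : 0 ≤ γ * ∑ s, (ν s)⁻ * Pmat T π s s' :=
      mul_nonneg hγ0 (Finset.sum_nonneg fun s _ =>
        mul_nonneg (negPart_nonneg _) (Pmat_nonneg hT hπ s s'))
    have hle : -∑ s, (ν s)⁻ * Pmat T π s s' ≤ ∑ s, ν s * Pmat T π s s' := by
      rw [← Finset.sum_neg_distrib]
      refine Finset.sum_le_sum fun s _ => ?_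
      rw [← neg_mul]
      exact mul_le_mul_of_nonneg_right (neg_le.1 (neg_le_negPart _)) (Pmat_nonneg hT hπ s s')
    have hflow := hν s'
    rw [sum_sum_eq_sum_mul_Pmat] at hflow
    rw [negPart_def]
    refine sup_le ?_ hR
    nlinarith [hd0.1 s', mul_le_mul_of_nonneg_left hle hγ0]

/-- A state never visited under a fully mixed policy is never visited under any policy. -/
lemma IsOccupancy.eq_zero_of_piPlus (hd0 : IsDist d0) (hγ0 : 0 ≤ γ) (hγ1 : γ < 1)
    (hT : IsTransModel T) {x y : S → A → ℝ} (hx : x ∈ PiPlus) (hy : IsPolicy y)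
    {μ ν : S → ℝ} (hμ : IsOccupancy T d0 γ x μ) (hν : IsOccupancy T d0 γ y ν)
    {s : S} (hs : μ s = 0) : ν s = 0 := by
  classical
  have hμ0 := hμ.nonneg hd0 hγ0 hγ1 hT hx.1
  have hν0 := hν.nonneg hd0 hγ0 hγ1 hT hy
  have hw := eq_zero_of_le_discounted (w := fun s => if μ s = 0 then ν s else 0) hγ1 hT hy
    (fun s => by split_ifs <;> simp [hν0 s]) (fun s' => ?_) s
  · simpa [hs] using hw
  · split_ifs with hs'
    · have hμflow := hμ s'
      have hterm (s : S) (a : A) : 0 ≤ μ s * x s a * T s a s' :=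
        mul_nonneg (mul_nonneg (hμ0 s) (hx.2 s a).le) ((hT s a).1 s')
      have hsum0 : 0 ≤ γ * ∑ s, ∑ a, μ s * x s a * T s a s' :=
        mul_nonneg hγ0 (Finset.sum_nonneg fun s _ => Finset.sum_nonneg fun a _ => hterm s a)
      have hd : d0 s' = 0 := by linarith [hd0.1 s']
      rw [hν s', hd, zero_add, sum_sum_eq_sum_mul_Pmat]
      rcases hγ0.eq_or_lt with rfl | hγ
      · simp
      refine mul_le_mul_of_nonneg_left (Finset.sum_le_sum fun s _ => ?_) hγ0
      split_ifs with hs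
      · exact le_rfl
      have hzero : ∑ s, ∑ a, μ s * x s a * T s a s' = 0 := by
        rw [hs', hd, zero_add, eq_comm] at hμflow
        exact (mul_eq_zero.1 hμflow).resolve_left hγ.ne'
      have hrow := (Finset.sum_eq_zero_iff_of_nonneg fun s _ =>
        Finset.sum_nonneg fun a _ => hterm s a).1 hzero s (Finset.mem_univ s)
      have hT0 (a : A) : T s a s' = 0 := by
        have h := (Finset.sum_eq_zero_iff_of_nonneg fun a _ => hterm s a).1 hrow a
          (Finset.mem_univ a)
        exact (mul_eq_zero.1 h).resolve_left (mul_ne_zero hs (hx.2 s a).ne')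
      simp [Pmat, hT0]
    · refine mul_nonneg hγ0 (Finset.sum_nonneg fun s _ => mul_nonneg ?_ (Pmat_nonneg hT hy s s'))
      split_ifs <;> simp [hν0 s]

variable [DecidableEq S]

lemma det_one_sub_smul_Pmat_ne_zero (hγ0 : 0 ≤ γ) (hγ1 : γ < 1) (hT : IsTransModel T)
    (hπ : IsPolicy π) : ((1 : Matrix S S ℝ) - γ • Pmat T π).det ≠ 0 := by
  refine det_ne_zero_of_sum_row_lt_diag fun k => ?_
  have hsum := sum_Pmat hT hπ k
  rw [← Finset.add_sum_erase _ _ (Finset.mem_univ k)] at hsum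
  have hoff : ∑ j ∈ Finset.univ.erase k, ‖((1 : Matrix S S ℝ) - γ • Pmat T π) k j‖
      = γ * ∑ j ∈ Finset.univ.erase k, Pmat T π k j := by
    rw [Finset.mul_sum]
    refine Finset.sum_congr rfl fun j hj => ?_
    rw [Matrix.sub_apply, Matrix.one_apply_ne (Finset.ne_of_mem_erase hj).symm, zero_sub,
      norm_neg, Matrix.smul_apply, smul_eq_mul, Real.norm_eq_abs,
      abs_of_nonneg (mul_nonneg hγ0 (Pmat_nonneg hT hπ k j))]
  rw [hoff, Matrix.sub_apply, Matrix.one_apply_eq, Matrix.smul_apply, smul_eq_mul]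
  refine lt_of_lt_of_le ?_ (Real.le_norm_self _)
  nlinarith [hsum]

lemma analyticAt_Jval (hγ0 : 0 ≤ γ) (hγ1 : γ < 1) (hT : IsTransModel T) (hπ : IsPolicy π) :
    AnalyticAt ℝ (Jval T R d0 γ) π := by
  have hentry (s : S) (a : A) : AnalyticAt ℝ (fun p : S → A → ℝ => p s a) π :=
    ((ContinuousLinearMap.proj (R := ℝ) (φ := fun _ : A => ℝ) a).comp
      (ContinuousLinearMap.proj (R := ℝ) (φ := fun _ : S => A → ℝ) s)).analyticAt π
  have hlin (c : A → ℝ) (s : S) :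
      AnalyticAt ℝ (fun p : S → A → ℝ => ∑ a, p s a * c a) π :=
    Finset.analyticAt_fun_sum _ fun a _ => (hentry s a).mul analyticAt_const
  unfold Jval
  simp only [Matrix.mulVec, dotProduct, rvec]
  refine Finset.analyticAt_fun_sum _ fun s _ => analyticAt_const.mul <|
    Finset.analyticAt_fun_sum _ fun s' _ => .mul ?_ (hlin _ _)
  refine analyticAt_matrix_inv (M := fun p => (1 : Matrix S S ℝ) - γ • Pmat T p) (fun i j => ?_)
    (det_one_sub_smul_Pmat_ne_zero hγ0 hγ1 hT hπ) s s'
  simp only [Matrix.sub_apply, Matrix.smul_apply, smul_eq_mul, Pmat, Matrix.of_apply]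
  exact analyticAt_const.sub (analyticAt_const.mul (hlin _ _))

lemma isOccupancy_iff_vecMul {ν : S → ℝ} :
    IsOccupancy T d0 γ π ν ↔ ν ᵥ* ((1 : Matrix S S ℝ) - γ • Pmat T π) = d0 := by
  rw [funext_iff]
  refine forall_congr' fun s' => ?_
  rw [sum_sum_eq_sum_mul_Pmat, Matrix.vecMul_sub, Matrix.vecMul_one, Matrix.vecMul_smul,
    Pi.sub_apply, Pi.smul_apply, smul_eq_mul, sub_eq_iff_eq_add]
  rfl

lemma IsOccupancy.Jval_eq (hγ0 : 0 ≤ γ) (hγ1 : γ < 1) (hT : IsTransModel T) (hπ : IsPolicy π)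
    {ν : S → ℝ} (hν : IsOccupancy T d0 γ π ν) :
    Jval T R d0 γ π = ∑ s, ∑ a, ν s * π s a * R s a := by
  have hu := (det_one_sub_smul_Pmat_ne_zero hγ0 hγ1 hT hπ).isUnit
  have hJ : Jval T R d0 γ π
      = d0 ⬝ᵥ (((1 : Matrix S S ℝ) - γ • Pmat T π)⁻¹ *ᵥ rvec R π) := rfl
  rw [hJ, ← isOccupancy_iff_vecMul.1 hν, ← Matrix.dotProduct_mulVec, Matrix.mulVec_mulVec,
    Matrix.mul_nonsing_inv _ hu, Matrix.one_mulVec]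
  simp only [dotProduct, rvec, Finset.mul_sum, mul_assoc]

lemma exists_isOccupancy (hγ0 : 0 ≤ γ) (hγ1 : γ < 1) (hT : IsTransModel T)
    (hπ : IsPolicy π) : ∃ ν, IsOccupancy T d0 γ π ν := by
  have hu := (det_one_sub_smul_Pmat_ne_zero hγ0 hγ1 hT hπ).isUnit
  refine ⟨d0 ᵥ* ((1 : Matrix S S ℝ) - γ • Pmat T π)⁻¹, isOccupancy_iff_vecMul.2 ?_⟩
  rw [Matrix.vecMul_vecMul, Matrix.nonsing_inv_mul _ hu, Matrix.vecMul_one]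

/-! ### Mixing policies along straight lines of occupancies -/

/-- `f` is affine along an analytic path joining any two points of `Q` inside `Q`. -/
def HasAffinePaths {E : Type*} [NormedAddCommGroup E] [NormedSpace ℝ E] (Q : Set E)
    (f : E → ℝ) : Prop :=
  ∀ x ∈ Q, ∀ y ∈ Q, ∃ m : ℝ → E, m 0 = x ∧ m 1 = y ∧ (∀ t ∈ Set.Icc (0 : ℝ) 1, m t ∈ Q) ∧
    AnalyticOnNhd ℝ m (Set.Icc 0 1) ∧
    ∀ t ∈ Set.Icc (0 : ℝ) 1, f (m t) = (1 - t) * f x + t * f y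

lemma hasAffinePaths_Jval (hd0 : IsDist d0) (hγ0 : 0 ≤ γ) (hγ1 : γ < 1) (hT : IsTransModel T) :
    HasAffinePaths PiPlus (Jval T R d0 γ) := by
  classical
  intro x hx y hy
  obtain ⟨μ, hμ⟩ := exists_isOccupancy (d0 := d0) hγ0 hγ1 hT hx.1
  obtain ⟨ν, hν⟩ := exists_isOccupancy (d0 := d0) hγ0 hγ1 hT hy.1
  have hμ0 := hμ.nonneg hd0 hγ0 hγ1 hT hx.1
  have hν0 := hν.nonneg hd0 hγ0 hγ1 hT hy.1
  have hμν (s : S) (h : μ s = 0) : ν s = 0 :=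
    hμ.eq_zero_of_piPlus hd0 hγ0 hγ1 hT hx hy.1 hν h
  have hνμ (s : S) (h : ν s = 0) : μ s = 0 :=
    hν.eq_zero_of_piPlus hd0 hγ0 hγ1 hT hy hx.1 hμ h
  obtain ⟨a, ha, ha'⟩ : ∃ a : S → ℝ, (∀ s, 0 < a s) ∧ ∀ s, μ s ≠ 0 → a s = μ s :=
    ⟨fun s => if μ s = 0 then 1 else μ s, fun s => by
      dsimp only
      split_ifs with h
      · exact one_pos
      · exact (hμ0 s).lt_of_ne' h, fun s h => if_neg h⟩
  obtain ⟨b, hb, hb'⟩ : ∃ b : S → ℝ, (∀ s, 0 < b s) ∧ ∀ s, ν s ≠ 0 → b s = ν s :=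
    ⟨fun s => if ν s = 0 then 1 else ν s, fun s => by
      dsimp only
      split_ifs with h
      · exact one_pos
      · exact (hν0 s).lt_of_ne' h, fun s h => if_neg h⟩
  have hD (t : ℝ) (ht : t ∈ Set.Icc (0 : ℝ) 1) (u v : ℝ) (hu : 0 < u) (hv : 0 < v) :
      0 < (1 - t) * u + t * v := by
    rcases ht.1.eq_or_lt with rfl | h0
    · simpa using hu
    · exact add_pos_of_nonneg_of_pos (mul_nonneg (by linarith [ht.2]) hu.le) (mul_pos h0 hv)
  set m : ℝ → S → A → ℝ := fun t s c =>
    ((1 - t) * (a s * x s c) + t * (b s * y s c)) / ((1 - t) * a s + t * b s) with hm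
  have hmQ (t : ℝ) (ht : t ∈ Set.Icc (0 : ℝ) 1) : m t ∈ PiPlus := by
    have hpos (s : S) (c : A) : 0 < m t s c :=
      div_pos (hD t ht _ _ (mul_pos (ha s) (hx.2 s c)) (mul_pos (hb s) (hy.2 s c)))
        (hD t ht _ _ (ha s) (hb s))
    refine ⟨fun s => ⟨fun c => (hpos s c).le, ?_⟩, hpos⟩
    rw [hm]
    dsimp only
    rw [← Finset.sum_div, Finset.sum_add_distrib, ← Finset.mul_sum, ← Finset.mul_sum,
      ← Finset.mul_sum, ← Finset.mul_sum, (hx.1 s).2, (hy.1 s).2, mul_one, mul_one]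
    exact div_self (hD t ht _ _ (ha s) (hb s)).ne'
  have hflow (t : ℝ) (ht : t ∈ Set.Icc (0 : ℝ) 1) (s : S) (c : A) :
      ((1 - t) * μ s + t * ν s) * m t s c
        = (1 - t) * (μ s * x s c) + t * (ν s * y s c) := by
    by_cases h : μ s = 0
    · simp [h, hμν s h]
    · have hpos := (hD t ht _ _ (ha s) (hb s)).ne'
      rw [← ha' s h, ← hb' s fun h' => h (hνμ s h')]
      exact mul_div_cancel₀ _ hpos
  have hlin (t : ℝ) (ht : t ∈ Set.Icc (0 : ℝ) 1) (w : S → A → ℝ) :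
      ∑ s, ∑ c, ((1 - t) * μ s + t * ν s) * m t s c * w s c
        = (1 - t) * ∑ s, ∑ c, μ s * x s c * w s c + t * ∑ s, ∑ c, ν s * y s c * w s c := by
    simp only [hflow t ht, add_mul, Finset.sum_add_distrib, Finset.mul_sum, mul_assoc]
  refine ⟨m, ?_, ?_, hmQ, fun t ht => ?_, fun t ht => ?_⟩
  · funext s c
    simp [hm, (ha s).ne']
  · funext s c
    simp [hm, (hb s).ne']
  · refine AnalyticAt.pi fun s => AnalyticAt.pi fun c => ?_
    have hden := (hD t ht _ _ (ha s) (hb s)).ne'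
    exact AnalyticAt.div (by fun_prop) (by fun_prop) hden
  · have hocc : IsOccupancy T d0 γ (m t) fun s => (1 - t) * μ s + t * ν s := fun s' => by
      dsimp only
      rw [hlin t ht fun s c => T s c s']
      linear_combination (1 - t) * hμ s' + t * hν s'
    rw [hocc.Jval_eq hγ0 hγ1 hT (hmQ t ht).1, hμ.Jval_eq hγ0 hγ1 hT hx.1,
      hν.Jval_eq hγ0 hγ1 hT hy.1, hlin t ht R]

end ValueInversion

section Closure

open Filter Topology

variable {E : Type*} [TopologicalSpace E] {Q : Set E} {f g : E → ℝ}

/-- Strict monotonicity of `g` in `f` on a preconnected set extends to its closure. -/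
lemma lt_of_mem_closure (hQ : IsPreconnected Q) (hf : ContinuousOn f Q)
    (hlt : ∀ x ∈ Q, ∀ y ∈ Q, f y < f x → g y < g x) {p q : E} (hp : p ∈ closure Q)
    (hq : q ∈ closure Q) (hfp : ContinuousAt f p) (hfq : ContinuousAt f q)
    (hgp : ContinuousAt g p) (hgq : ContinuousAt g q) (hpq : f q < f p) : g q < g p := by
  have : (𝓝[Q] p).NeBot := mem_closure_iff_nhdsWithin_neBot.1 hp
  have : (𝓝[Q] q).NeBot := mem_closure_iff_nhdsWithin_neBot.1 hq
  have hfp' : Tendsto f (𝓝[Q] p) (𝓝 (f p)) := hfp.mono_left nhdsWithin_le_nhds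
  have hfq' : Tendsto f (𝓝[Q] q) (𝓝 (f q)) := hfq.mono_left nhdsWithin_le_nhds
  obtain ⟨c, hqc, hcp⟩ := exists_between hpq
  obtain ⟨d, hcd, hdp⟩ := exists_between hcp
  obtain ⟨p', hp'd, hp'Q⟩ := ((hfp'.eventually (lt_mem_nhds hdp)).and self_mem_nhdsWithin).exists
  obtain ⟨q', hq'c, hq'Q⟩ := ((hfq'.eventually (gt_mem_nhds hqc)).and self_mem_nhdsWithin).exists
  have himg := hQ.intermediate_value hq'Q hp'Q hf
  obtain ⟨w, hw, rfl⟩ := himg ⟨hq'c.le, (hcd.trans hp'd).le⟩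
  obtain ⟨z, hz, rfl⟩ := himg ⟨(hq'c.trans hcd).le, hp'd.le⟩
  have hzp : g z ≤ g p := ge_of_tendsto (hgp.mono_left nhdsWithin_le_nhds) <| by
    filter_upwards [hfp'.eventually (lt_mem_nhds hdp), self_mem_nhdsWithin] with v hv hvQ
    exact (hlt v hvQ z hz hv).le
  have hqw : g q ≤ g w := le_of_tendsto (hgq.mono_left nhdsWithin_le_nhds) <| by
    filter_upwards [hfq'.eventually (gt_mem_nhds hqc), self_mem_nhdsWithin] with v hv hvQ
    exact (hlt w hw v hvQ hv).le
  exact hqw.trans_lt ((hlt z hz w hw hcd).trans_le hzp)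

/-- A continuous function nonconstant on the closure of `Q` is nonconstant on `Q`. -/
lemma exists_ne_of_mem_closure {p q : E} (hp : p ∈ closure Q) (hq : q ∈ closure Q)
    (hgp : ContinuousAt g p) (hgq : ContinuousAt g q) (hpq : g p ≠ g q) :
    ∃ z ∈ Q, ∃ z' ∈ Q, g z ≠ g z' := by
  by_contra! hconst
  have : (𝓝[Q] p).NeBot := mem_closure_iff_nhdsWithin_neBot.1 hp
  have : (𝓝[Q] q).NeBot := mem_closure_iff_nhdsWithin_neBot.1 hq
  obtain ⟨z, hz⟩ := closure_nonempty_iff.1 ⟨p, hp⟩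
  have hval {r : E} (hr : (𝓝[Q] r).NeBot) (hgr : ContinuousAt g r) : g r = g z :=
    tendsto_nhds_unique (hgr.mono_left nhdsWithin_le_nhds) <|
      tendsto_const_nhds.congr' <| by
        filter_upwards [self_mem_nhdsWithin] with v hv using hconst z hz v hv
  exact hpq ((hval ‹_› hgp).trans (hval ‹_› hgq).symm)

end Closure

section OrderTransfer

open Filter Topology

variable {E : Type*} [NormedAddCommGroup E] [NormedSpace ℝ E] {Q U : Set E} {f g : E → ℝ}

/-- From a point of `U ∩ Q`, small steps along a path in `Q` stay in `U ∩ Q`. -/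
lemma eventually_path_mem (hU : IsOpen U) {m : ℝ → E} (h0 : m 0 ∈ U)
    (hmQ : ∀ t ∈ Set.Icc (0 : ℝ) 1, m t ∈ Q) (hm : AnalyticOnNhd ℝ m (Set.Icc 0 1)) :
    ∀ᶠ t in 𝓝[>] (0 : ℝ), t ∈ Set.Ioo (0 : ℝ) 1 ∧ m t ∈ U ∩ Q := by
  have hc : ContinuousAt m 0 := (hm 0 (by simp)).continuousAt
  filter_upwards [nhdsWithin_le_nhds (hc.preimage_mem_nhds (hU.mem_nhds h0)),
    Ioo_mem_nhdsGT (zero_lt_one' ℝ)] with t htU ht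
  exact ⟨ht, htU, hmQ t ⟨ht.1.le, ht.2.le⟩⟩

/-- A point of `U ∩ Q` can be moved slightly within `U ∩ Q` so that `g` moves towards `g z`
while `f` stays in a prescribed neighbourhood. -/
lemma exists_perturb (hU : IsOpen U) (hg : HasAffinePaths Q g) {x z : E}
    (hf : ContinuousAt f x) (hx : x ∈ U ∩ Q) (hz : z ∈ Q) {V : Set ℝ} (hV : V ∈ 𝓝 (f x)) :
    ∃ t ∈ Set.Ioo (0 : ℝ) 1, ∃ w ∈ U ∩ Q, f w ∈ V ∧ g w = (1 - t) * g x + t * g z := by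
  obtain ⟨m, rfl, -, hmQ, hma, hmg⟩ := hg x hx.2 z hz
  have hc : ContinuousAt m 0 := (hma 0 (by simp)).continuousAt
  have hfm : ∀ᶠ t in 𝓝[>] (0 : ℝ), f (m t) ∈ V :=
    nhdsWithin_le_nhds ((hf.comp hc).preimage_mem_nhds hV)
  obtain ⟨t, htV, ht, htU⟩ := (hfm.and (eventually_path_mem hU hx.1 hmQ hma)).exists
  exact ⟨t, ht, m t, htU, htV, hmg t ⟨ht.1.le, ht.2.le⟩⟩

/-- If `g` is weakly monotone in `f` on `U ∩ Q`, then `f` cannot separate a level set of `g`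
there. -/
lemma le_of_level_eq (hU : IsOpen U) (hg : HasAffinePaths Q g)
    (hf : ∀ x ∈ Q, ContinuousAt f x) (hnc : ∃ z ∈ Q, ∃ z' ∈ Q, g z ≠ g z')
    (hmono : ∀ x ∈ U ∩ Q, ∀ y ∈ U ∩ Q, f y < f x → g y ≤ g x)
    {x y : E} (hx : x ∈ U ∩ Q) (hy : y ∈ U ∩ Q) (hxy : g x = g y) : f y ≤ f x := by
  by_contra! hlt
  have hex : ∃ z ∈ Q, g z ≠ g x := by
    obtain ⟨z, hz, z', hz', hne⟩ := hnc
    by_cases h : g z = g x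
    · exact ⟨z', hz', fun h' => hne (h.trans h'.symm)⟩
    · exact ⟨z, hz, h⟩
  obtain ⟨z, hz, hne⟩ := hex
  rcases hne.lt_or_gt with hzx | hzx
  · obtain ⟨t, ht, w, hw, hfw, hgw⟩ :=
      exists_perturb hU hg (hf y hy.2) hy hz (Ioi_mem_nhds hlt)
    have := hmono w hw x hx hfw
    nlinarith [ht.1]
  · obtain ⟨t, ht, w, hw, hfw, hgw⟩ :=
      exists_perturb hU hg (hf x hx.2) hx hz (Iio_mem_nhds hlt)
    have := hmono y hy w hw hfw
    nlinarith [ht.1]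

/-- Level sets of `g` refining those of `f` on a relatively open subset do so on all of `Q`. -/
lemma level_eq_of_local (hU : IsOpen U) (hUQ : (U ∩ Q).Nonempty) (hg : HasAffinePaths Q g)
    (hf : ∀ x ∈ Q, AnalyticAt ℝ f x)
    (hloc : ∀ x ∈ U ∩ Q, ∀ y ∈ U ∩ Q, g x = g y → f x = f y)
    {x y : E} (hx : x ∈ Q) (hy : y ∈ Q) (hxy : g x = g y) : f x = f y := by
  obtain ⟨x₀, hx₀⟩ := hUQ
  obtain ⟨m, hm0, rfl, hmQ, hma, hmg⟩ := hg x₀ hx₀.2 x hx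
  obtain ⟨n, hn0, rfl, hnQ, hna, hng⟩ := hg x₀ hx₀.2 y hy
  have hev : ∀ᶠ t in 𝓝[>] (0 : ℝ), f (m t) = f (n t) := by
    filter_upwards [eventually_path_mem hU (hm0 ▸ hx₀.1) hmQ hma,
      eventually_path_mem hU (hn0 ▸ hx₀.1) hnQ hna] with t htm htn
    have ht := Set.Ioo_subset_Icc_self htm.1
    exact hloc _ htm.2 _ htn.2 (by rw [hmg t ht, hng t ht, hxy])
  have hfreq : ∃ᶠ t in 𝓝[≠] (0 : ℝ), f (m t) = f (n t) :=
    hev.frequently.filter_mono (nhdsWithin_mono _ fun t ht => ne_of_gt ht)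
  have hfm : AnalyticOnNhd ℝ (fun t => f (m t)) (Set.Icc 0 1) := fun t ht =>
    (hf _ (hmQ t ht)).comp (hma t ht)
  have hfn : AnalyticOnNhd ℝ (fun t => f (n t)) (Set.Icc 0 1) := fun t ht =>
    (hf _ (hnQ t ht)).comp (hna t ht)
  exact hfm.eqOn_of_preconnected_of_frequently_eq hfn isPreconnected_Icc
    (Set.left_mem_Icc.2 zero_le_one) hfreq (Set.right_mem_Icc.2 zero_le_one)

/-- Local weak monotonicity of `g` in `f` becomes strict monotonicity on `Q` once the level sets
of `g` refine those of `f`. -/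
lemma lt_of_local_mono (hU : IsOpen U) (hUQ : (U ∩ Q).Nonempty) (hf : HasAffinePaths Q f)
    (hg : ∀ x ∈ Q, ContinuousAt g x)
    (hmono : ∀ x ∈ U ∩ Q, ∀ y ∈ U ∩ Q, f y < f x → g y ≤ g x)
    (hlevel : ∀ x ∈ Q, ∀ y ∈ Q, g x = g y → f x = f y)
    {x y : E} (hx : x ∈ Q) (hy : y ∈ Q) (hxy : f y < f x) : g y < g x := by
  obtain ⟨x₀, hx₀⟩ := hUQ
  obtain ⟨m, hm0, rfl, hmQ, hma, hmf⟩ := hf x₀ hx₀.2 x hx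
  obtain ⟨n, hn0, rfl, hnQ, hna, hnf⟩ := hf x₀ hx₀.2 y hy
  have hlt (t : ℝ) (ht0 : 0 < t) (ht1 : t ≤ 1) : f (n t) < f (m t) := by
    rw [hmf t ⟨ht0.le, ht1⟩, hnf t ⟨ht0.le, ht1⟩]
    nlinarith
  obtain ⟨t, ⟨ht, htm⟩, -, htn⟩ := ((eventually_path_mem hU (hm0 ▸ hx₀.1) hmQ hma).and
    (eventually_path_mem hU (hn0 ▸ hx₀.1) hnQ hna)).exists
  by_contra! hle
  have hsub : Set.Icc t 1 ⊆ Set.Icc (0 : ℝ) 1 := Set.Icc_subset_Icc_left ht.1.le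
  have hcm : ContinuousOn (fun u => g (m u)) (Set.Icc t 1) := fun u hu =>
    ((hg _ (hmQ u (hsub hu))).comp (hma u (hsub hu)).continuousAt).continuousWithinAt
  have hcn : ContinuousOn (fun u => g (n u)) (Set.Icc t 1) := fun u hu =>
    ((hg _ (hnQ u (hsub hu))).comp (hna u (hsub hu)).continuousAt).continuousWithinAt
  obtain ⟨u, hu, hgu⟩ := isPreconnected_Icc.intermediate_value₂
    (Set.left_mem_Icc.2 ht.2.le) (Set.right_mem_Icc.2 ht.2.le) hcn hcm
    (hmono _ htm _ htn (hlt t ht.1 ht.2.le)) hle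
  exact (hlt u (ht.1.trans_le hu.1) hu.2).ne
    (hlevel _ (hnQ u (hsub hu)) _ (hmQ u (hsub hu)) hgu)

/-- Weak monotonicity of `g` in `f` on a nonempty relatively open part of `Q` forces strict
monotonicity on the closure. -/
lemma lt_of_local_mono_closure (hU : IsOpen U) (hUQ : (U ∩ Q).Nonempty) (hQ : IsPreconnected Q)
    (hf : HasAffinePaths Q f) (hg : HasAffinePaths Q g)
    (hfa : ∀ x ∈ closure Q, AnalyticAt ℝ f x) (hga : ∀ x ∈ closure Q, AnalyticAt ℝ g x)
    (hnc : ∃ z ∈ closure Q, ∃ z' ∈ closure Q, g z ≠ g z')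
    (hmono : ∀ x ∈ U ∩ Q, ∀ y ∈ U ∩ Q, f y < f x → g y ≤ g x)
    {p q : E} (hp : p ∈ closure Q) (hq : q ∈ closure Q) (hpq : f q < f p) : g q < g p := by
  have hfQ (x : E) (hx : x ∈ Q) : AnalyticAt ℝ f x := hfa x (subset_closure hx)
  have hgQ (x : E) (hx : x ∈ Q) : ContinuousAt g x := (hga x (subset_closure hx)).continuousAt
  obtain ⟨z, hz, z', hz', hne⟩ := hnc
  have hncQ := exists_ne_of_mem_closure hz hz' (hga z hz).continuousAt (hga z' hz').continuousAt hne
  have hloc : ∀ x ∈ U ∩ Q, ∀ y ∈ U ∩ Q, g x = g y → f x = f y := fun x hx y hy h =>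
    le_antisymm
      (le_of_level_eq hU hg (fun x hx => (hfQ x hx).continuousAt) hncQ hmono hy hx h.symm)
      (le_of_level_eq hU hg (fun x hx => (hfQ x hx).continuousAt) hncQ hmono hx hy h)
  refine lt_of_mem_closure hQ (fun x hx => (hfQ x hx).continuousAt.continuousWithinAt)
    (fun x hx y hy => lt_of_local_mono hU hUQ hf hgQ hmono
      (fun x hx y hy => level_eq_of_local hU hUQ hg hfQ hloc hx hy) hx hy)
    hp hq (hfa p hp).continuousAt (hfa q hq).continuousAt (hga p hp).continuousAt
    (hga q hq).continuousAt hpq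

end OrderTransfer

lemma convex_piPlus {S A : Type*} [Fintype A] : Convex ℝ (PiPlus : Set (S → A → ℝ)) := by
  intro x hx y hy a b ha hb hab
  have hpos (s : S) (c : A) : 0 < (a • x + b • y) s c := by
    simp only [Pi.add_apply, Pi.smul_apply, smul_eq_mul]
    rcases ha.eq_or_lt with rfl | ha
    · simpa [(zero_add b).symm.trans hab] using hy.2 s c
    · exact add_pos_of_pos_of_nonneg (mul_pos ha (hx.2 s c)) (mul_nonneg hb (hy.2 s c).le)
  refine ⟨fun s => ⟨fun c => (hpos s c).le, ?_⟩, hpos⟩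
  simp only [Pi.add_apply, Pi.smul_apply, smul_eq_mul, Finset.sum_add_distrib, ← Finset.mul_sum,
    (hx.1 s).2, (hy.1 s).2, mul_one, hab]

lemma isClosed_setOf_isPolicy {S A : Type*} [Fintype A] :
    IsClosed {p : S → A → ℝ | IsPolicy p} := by
  simp only [IsPolicy, Set.ofPred_forall, Set.ofPred_and]
  refine isClosed_iInter fun s => .inter (isClosed_iInter fun a => ?_) ?_
  · exact isClosed_le continuous_const (by fun_prop)
  · exact isClosed_eq (by fun_prop) continuous_const

lemma closure_piPlus {S A : Type*} [Fintype A] (hne : (PiPlus : Set (S → A → ℝ)).Nonempty) :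
    closure (PiPlus : Set (S → A → ℝ)) = {p | IsPolicy p} := by
  refine subset_antisymm (closure_minimal (fun p hp => hp.1) isClosed_setOf_isPolicy)
    fun p hp => ?_
  obtain ⟨u, hu⟩ := hne
  have hc : Filter.Tendsto (fun t : ℝ => (1 - t) • p + t • u) (nhdsWithin 0 (Set.Ioi 0))
      (nhds p) := by
    have h : Continuous fun t : ℝ => (1 - t) • p + t • u := by fun_prop
    simpa using (h.tendsto 0).mono_left nhdsWithin_le_nhds
  refine mem_closure_of_tendsto hc ?_
  filter_upwards [Ioo_mem_nhdsGT (zero_lt_one' ℝ)] with t ht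
  have hpos (s : S) (c : A) : 0 < ((1 - t) • p + t • u) s c :=
    add_pos_of_nonneg_of_pos (mul_nonneg (by linarith [ht.2]) ((hp s).1 c))
      (mul_pos ht.1 (hu.2 s c))
  refine ⟨fun s => ⟨fun c => (hpos s c).le, ?_⟩, hpos⟩
  simp only [Pi.add_apply, Pi.smul_apply, smul_eq_mul, Finset.sum_add_distrib, ← Finset.mul_sum,
    (hp s).2, (hu.1 s).2]
  ring

/-- **Value inversion theorem**: on any policy set containing a nonempty subset
open in `Π⁺`, any two non-trivial, non-equivalent MDP value functions
(induced by transition models `T_i` and rewards `R_i`) admit a value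
inversion. -/
theorem stmt8 {S A : Type*} [Fintype S] [Fintype A] [DecidableEq S] [Nonempty S]
    (hA : 1 < Fintype.card A)
    (d0 : S → ℝ) (hd0 : IsDist d0)
    (γ : ℝ) (hγ0 : 0 ≤ γ) (hγ1 : γ < 1)
    (T₁ T₂ : S → A → S → ℝ) (hT₁ : IsTransModel T₁) (hT₂ : IsTransModel T₂)
    (R₁ R₂ : S → A → ℝ)
    (Ps : Set (S → A → ℝ)) (hPs : ∀ p ∈ Ps, IsPolicy p)
    -- `Ps` contains a nonempty subset open in `Π⁺`
    (hopen : ∃ Pt : Set (S → A → ℝ), Pt ⊆ Ps ∧ Pt.Nonempty ∧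
      ∃ U : Set (S → A → ℝ), IsOpen U ∧ Pt = U ∩ PiPlus)
    -- `J_1` is non-constant on `Ps`
    (hnc1 : ∃ π ∈ Ps, ∃ π' ∈ Ps, Jval T₁ R₁ d0 γ π ≠ Jval T₁ R₁ d0 γ π')
    -- `J_2` is non-constant on `Ps`
    (hnc2 : ∃ π ∈ Ps, ∃ π' ∈ Ps, Jval T₂ R₂ d0 γ π ≠ Jval T₂ R₂ d0 γ π')
    -- `J_1` and `J_2` do not induce the same ordering on `Ps`
    (hneq : ¬ ∀ π ∈ Ps, ∀ π' ∈ Ps,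
      (Jval T₁ R₁ d0 γ π' ≤ Jval T₁ R₁ d0 γ π ↔
        Jval T₂ R₂ d0 γ π' ≤ Jval T₂ R₂ d0 γ π)) :
    ∃ π ∈ Ps, ∃ π' ∈ Ps,
      Jval T₁ R₁ d0 γ π' < Jval T₁ R₁ d0 γ π ∧
      Jval T₂ R₂ d0 γ π < Jval T₂ R₂ d0 γ π' := by
  obtain ⟨_, hPtPs, hPtne, U, hU, rfl⟩ := hopen
  have hcl := closure_piPlus (hPtne.mono Set.inter_subset_right)
  have hmem {p : S → A → ℝ} (hp : p ∈ Ps) : p ∈ closure (PiPlus : Set (S → A → ℝ)) := by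
    rw [hcl]
    exact hPs p hp
  have han (T : S → A → S → ℝ) (R : S → A → ℝ) (hT : IsTransModel T) (p : S → A → ℝ)
      (hp : p ∈ closure (PiPlus : Set (S → A → ℝ))) : AnalyticAt ℝ (Jval T R d0 γ) p := by
    rw [hcl] at hp
    exact analyticAt_Jval hγ0 hγ1 hT hp
  have hpath (T : S → A → S → ℝ) (R : S → A → ℝ) (hT : IsTransModel T) :
      HasAffinePaths PiPlus (Jval T R d0 γ) := hasAffinePaths_Jval hd0 hγ0 hγ1 hT
  by_contra! hno
  refine hneq fun p hp q hq => ?_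
  obtain ⟨z₁, hz₁, w₁, hw₁, hne₁⟩ := hnc1
  obtain ⟨z₂, hz₂, w₂, hw₂, hne₂⟩ := hnc2
  have h12 := lt_of_local_mono_closure hU hPtne convex_piPlus.isPreconnected
    (hpath T₁ R₁ hT₁) (hpath T₂ R₂ hT₂) (han T₁ R₁ hT₁) (han T₂ R₂ hT₂)
    ⟨z₂, hmem hz₂, w₂, hmem hw₂, hne₂⟩
    (fun x hx y hy => hno x (hPtPs hx) y (hPtPs hy)) (hmem hq) (hmem hp)
  have h21 := lt_of_local_mono_closure hU hPtne convex_piPlus.isPreconnected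
    (hpath T₂ R₂ hT₂) (hpath T₁ R₁ hT₁) (han T₂ R₂ hT₂) (han T₁ R₁ hT₁)
    ⟨z₁, hmem hz₁, w₁, hmem hw₁, hne₁⟩
    (fun x hx y hy hlt => not_lt.1 fun h =>
      (hno y (hPtPs hy) x (hPtPs hx) h).not_gt hlt) (hmem hq) (hmem hp)
  exact ⟨fun h => not_lt.1 fun h' => h.not_gt (h21 h'),
    fun h => not_lt.1 fun h' => h.not_gt (h12 h')⟩
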